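/- Fix d ≥ 1 and a set D ⊆ [0,1] with no strictly decreasing sequence of elements (DCC). Consider all configurations consisting of finitely many primitive vectors e_1, …, e_n ∈ ℤ^d such that the cone σ = Σ_{i=1}^n ℝ_{≥0} • e_i spans ℝ^d, satisfies σ ∩ (−σ) = {0}, and each ray ℝ_{≥0} • e_i is an extremal ray of σ, together with a linear form ψ : ℝ^d → ℝ such that ψ(e_i) ≥ 0 and 1 − ψ(e_i) ∈ D for every i. Then the set of all real numbers a = inf{ψ(v) : v ∈ ℤ^d ∩ interior σ} arising from such configurations contains no strictly increasing sequence (it satisfies ACC). -/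

import Mathlib

open Pointwise

/-- The integer lattice `ℤ^d` inside `ℝ^d`. -/
def intLat (d : ℕ) : Set (Fin d → ℝ) := {x | ∀ i, ∃ z : ℤ, x i = (z : ℝ)}

/-- A vector of `ℤ^d` is primitive if it is nonzero and the gcd of its coordinates is `1`. -/
def Primitive {d : ℕ} (e : Fin d → ℤ) : Prop :=
  e ≠ 0 ∧ Finset.univ.gcd (fun i => (e i).natAbs) = 1

/-- A set of reals satisfies the ascending chain condition if it admits no strictly
increasing sequence. -/
def ACCSet (A : Set ℝ) : Prop := ¬ ∃ f : ℕ → ℝ, StrictMono f ∧ ∀ n, f n ∈ A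

/-- A set of reals satisfies the descending chain condition if it admits no strictly
decreasing sequence. -/
def DCCSet (D : Set ℝ) : Prop := ¬ ∃ f : ℕ → ℝ, StrictAnti f ∧ ∀ n, f n ∈ D

/-- The real vector associated to an integer vector. -/
def toReal {d : ℕ} (e : Fin d → ℤ) : Fin d → ℝ := fun i => (e i : ℝ)

/-- The cone `Σ_i ℝ_{≥0} • e_i` generated by a finite family of integer vectors. -/
def coneOf {d n : ℕ} (e : Fin n → Fin d → ℤ) : Set (Fin d → ℝ) :=
  {x | ∃ c : Fin n → ℝ, (∀ i, 0 ≤ c i) ∧ x = ∑ i, c i • toReal (e i)}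

/-- The ray `ℝ_{≥0} • v`. -/
def rayOf {d : ℕ} (v : Fin d → ℝ) : Set (Fin d → ℝ) := {w | ∃ r : ℝ, 0 ≤ r ∧ w = r • v}

/-- `ℝ_{≥0} • v` is an extremal ray of the convex cone `σ`. -/
def IsExtremalRay {d : ℕ} (σ : Set (Fin d → ℝ)) (v : Fin d → ℝ) : Prop :=
  ∀ x ∈ σ, ∀ y ∈ σ, x + y ∈ rayOf v → x ∈ rayOf v ∧ y ∈ rayOf v

open Filter Topology

section UltrafilterLimit

variable {ι E : Type*} [NormedAddCommGroup E]

/-- The limit of a family of subgroups along a filter: the points all of whose neighbourhoods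
eventually meet the subgroups. -/
def limSubgroup (F : Filter ι) (N : ι → AddSubgroup E) : AddSubgroup E where
  carrier := {x | ∀ ε > 0, ∀ᶠ k in F, ∃ y ∈ N k, ‖y - x‖ < ε}
  zero_mem' := fun ε hε => .of_forall fun k => ⟨0, (N k).zero_mem, by simpa using hε⟩
  add_mem' := by
    intro a b ha hb ε hε
    filter_upwards [ha (ε / 2) (half_pos hε), hb (ε / 2) (half_pos hε)]
    rintro k ⟨y, hy, hya⟩ ⟨z, hz, hzb⟩
    refine ⟨y + z, (N k).add_mem hy hz, ?_⟩
    calc ‖y + z - (a + b)‖ = ‖(y - a) + (z - b)‖ := by congr 1; abel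
      _ ≤ ‖y - a‖ + ‖z - b‖ := norm_add_le _ _
      _ < ε := by linarith
  neg_mem' := by
    intro a ha ε hε
    filter_upwards [ha ε hε]
    rintro k ⟨y, hy, hya⟩
    refine ⟨-y, (N k).neg_mem hy, ?_⟩
    rwa [← neg_add', norm_neg, ← sub_eq_add_neg]

lemma mem_limSubgroup {F : Filter ι} {N : ι → AddSubgroup E} {x : E} :
    x ∈ limSubgroup F N ↔ ∀ ε > 0, ∀ᶠ k in F, ∃ y ∈ N k, ‖y - x‖ < ε := Iff.rfl

lemma isClosed_limSubgroup (F : Filter ι) (N : ι → AddSubgroup E) :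
    IsClosed (limSubgroup F N : Set E) := by
  refine isClosed_of_closure_subset fun x hx ε hε => ?_
  obtain ⟨z, hz, hxz⟩ := Metric.mem_closure_iff.1 hx (ε / 2) (half_pos hε)
  filter_upwards [hz (ε / 2) (half_pos hε)]
  rintro k ⟨y, hy, hyz⟩
  refine ⟨y, hy, ?_⟩
  rw [dist_comm, dist_eq_norm] at hxz
  calc ‖y - x‖ = ‖(y - z) + (z - x)‖ := by congr 1; abel
    _ ≤ ‖y - z‖ + ‖z - x‖ := norm_add_le _ _
    _ < ε := by linarith

lemma mem_limSubgroup_of_tendsto {F : Filter ι} {N : ι → AddSubgroup E} {g : ι → E} {x : E}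
    (hg : ∀ᶠ k in F, g k ∈ N k) (h : Tendsto g F (𝓝 x)) : x ∈ limSubgroup F N := by
  intro ε hε
  filter_upwards [hg, h (Metric.ball_mem_nhds x hε)] with k hk hk'
  exact ⟨g k, hk, by simpa [dist_eq_norm] using hk'⟩

lemma exists_tendsto_of_norm_le [ProperSpace E] (U : Ultrafilter ι) {g : ι → E} {R : ℝ}
    (h : ∀ k, ‖g k‖ ≤ R) : ∃ x, Tendsto g U (𝓝 x) := by
  obtain ⟨x, -, hx⟩ := (isCompact_closedBall (0 : E) R).ultrafilter_le_nhds (U.map g)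
    (by
      rw [Ultrafilter.coe_map, le_principal_iff, mem_map]
      exact univ_mem' fun k => by simpa using h k)
  exact ⟨x, hx⟩

/-- Subgroups containing a common cocompact subgroup get uniformly close to their limit. -/
lemma exists_limSubgroup_tendsto_sub [ProperSpace E] (U : Ultrafilter ι)
    {N : ι → AddSubgroup E} {L : AddSubgroup E} {R : ℝ} (hL : ∀ k, L ≤ N k)
    (hR : ∀ x, ∃ z ∈ L, ‖x - z‖ ≤ R) {g : ι → E} (hg : ∀ᶠ k in U, g k ∈ N k) :
    ∃ p : ι → E, (∀ k, p k ∈ limSubgroup (U : Filter ι) N) ∧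
      Tendsto (fun k => g k - p k) U (𝓝 0) := by
  choose z hz hzR using hR
  obtain ⟨x, hx⟩ := exists_tendsto_of_norm_le U (g := fun k => g k - z (g k)) fun k => hzR (g k)
  have hxN : x ∈ limSubgroup (U : Filter ι) N := by
    refine mem_limSubgroup_of_tendsto ?_ hx
    filter_upwards [hg] with k hk
    exact (N k).sub_mem hk (hL k (hz _))
  refine ⟨fun k => x + z (g k), fun k => add_mem hxN fun ε hε => .of_forall fun l =>
    ⟨z (g k), hL l (hz _), by simpa using hε⟩, ?_⟩
  have := hx.sub_const x
  rw [sub_self] at this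
  exact this.congr fun k => by rw [sub_sub, add_comm]

/-- Along an ultrafilter, subgroups of `E` containing a common cocompact subgroup are eventually
contained in their limit (the torus has no small subgroups). -/
lemma eventually_le_limSubgroup [NormedSpace ℝ E] [ProperSpace E] (U : Ultrafilter ι)
    {N : ι → AddSubgroup E} {L : AddSubgroup E} {R : ℝ} (hL : ∀ k, L ≤ N k)
    (hR : ∀ x, ∃ z ∈ L, ‖x - z‖ ≤ R) :
    ∀ᶠ k in (U : Filter ι), N k ≤ limSubgroup (U : Filter ι) N := by
  set M := limSubgroup (U : Filter ι) N
  have hMc : IsClosed (M : Set E) := isClosed_limSubgroup _ _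
  by_contra hcon
  have hbad : ∀ᶠ k in (U : Filter ι), ∃ x ∈ N k, x ∉ M := by
    filter_upwards [Ultrafilter.eventually_not.2 hcon] with k hk
    exact SetLike.not_le_iff_exists.1 hk
  obtain ⟨x, hx⟩ : ∃ x : ι → E, ∀ᶠ k in (U : Filter ι), x k ∈ N k ∧ x k ∉ M :=
    hbad.choice
  have hnear : ∀ y : E, ∃ n ∈ (M : Set E), Metric.infDist y M = dist y n := fun y =>
    hMc.exists_infDist_eq_dist ⟨0, M.zero_mem⟩ y
  choose n hnM hn using hnear
  set b : ι → E := fun k => x k - n (x k) with hb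
  have hbmin : ∀ k, ∀ p ∈ M, ‖b k‖ ≤ ‖b k - p‖ := fun k p hp => by
    have h1 := Metric.infDist_le_dist_of_mem (x := x k) (s := (M : Set E))
      (add_mem (hnM (x k)) hp : n (x k) + p ∈ M)
    rw [hn, dist_eq_norm, dist_eq_norm] at h1
    calc ‖b k‖ ≤ ‖x k - (n (x k) + p)‖ := h1
      _ = ‖b k - p‖ := by rw [hb, sub_sub]
  have hb0 : ∀ᶠ k in (U : Filter ι), b k ≠ 0 := by
    filter_upwards [hx] with k hk h0
    exact hk.2 (by rw [sub_eq_zero.1 h0]; exact hnM _)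
  have hmul : ∀ m : ι → ℤ, ∃ p : ι → E, (∀ k, p k ∈ M) ∧
      Tendsto (fun k => m k • b k - p k) U (𝓝 0) := fun m => by
    obtain ⟨p, hp, hlim⟩ := exists_limSubgroup_tendsto_sub U hL hR (g := fun k => m k • x k)
      (by filter_upwards [hx] with k hk using (N k).zsmul_mem hk.1 _)
    refine ⟨fun k => p k - m k • n (x k), fun k => M.sub_mem (hp k) (M.zsmul_mem (hnM _) _),
      hlim.congr fun k => ?_⟩
    simp only [hb, zsmul_sub]
    abel
  have hblim : Tendsto (fun k => ‖b k‖) U (𝓝 0) := by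
    obtain ⟨p, hp, hlim⟩ := hmul fun _ => 1
    refine squeeze_zero (fun _ => norm_nonneg _) (fun k => ?_)
      (by simpa using hlim.norm : Tendsto (fun k => ‖b k - p k‖) U (𝓝 0))
    exact hbmin k _ (hp k)
  obtain ⟨u, hu⟩ := exists_tendsto_of_norm_le U (g := fun k => ‖b k‖⁻¹ • b k) (R := 1)
    fun k => by
      rw [norm_smul, norm_inv, norm_norm]
      exact inv_mul_le_one
  have hline : ∀ t : ℝ, t • u ∈ M := fun t => by
    obtain ⟨p, hp, hlim⟩ := hmul fun k => ⌊t / ‖b k‖⌋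
    have hcoef : Tendsto (fun k => (⌊t / ‖b k‖⌋ : ℝ) * ‖b k‖) U (𝓝 t) := by
      have : Tendsto (fun k => t - ‖b k‖) U (𝓝 t) := by simpa using hblim.const_sub t
      refine tendsto_of_tendsto_of_tendsto_of_le_of_le' this tendsto_const_nhds ?_ ?_
      · filter_upwards [hb0] with k hk
        have h0 : 0 < ‖b k‖ := norm_pos_iff.2 hk
        have h1 := (Int.lt_floor_add_one (t / ‖b k‖)).le
        rw [div_le_iff₀ h0] at h1
        linarith
      · filter_upwards [hb0] with k hk
        exact (le_div_iff₀ (norm_pos_iff.2 hk)).1 (Int.floor_le _)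
    have hmb : Tendsto (fun k => ⌊t / ‖b k‖⌋ • b k) U (𝓝 (t • u)) := by
      refine (hcoef.smul hu).congr' ?_
      filter_upwards [hb0] with k hk
      rw [smul_smul, mul_assoc, mul_inv_cancel₀ (norm_ne_zero_iff.2 hk), mul_one,
        Int.cast_smul_eq_zsmul]
    have hpt : Tendsto p U (𝓝 (t • u)) := by
      simpa using hmb.sub hlim
    exact hMc.mem_of_tendsto hpt (.of_forall hp)
  have hclose : ∀ᶠ k in (U : Filter ι), ‖‖b k‖⁻¹ • b k - u‖ < 1 := by
    filter_upwards [hu (Metric.ball_mem_nhds u one_pos)] with k hk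
    simpa [dist_eq_norm] using hk
  obtain ⟨k, hk0, hk1⟩ := (hb0.and hclose).exists
  have h0 : 0 < ‖b k‖ := norm_pos_iff.2 hk0
  have h1 := hbmin k _ (hline ‖b k‖)
  have h2 : b k - ‖b k‖ • u = ‖b k‖ • (‖b k‖⁻¹ • b k - u) := by
    rw [smul_sub, smul_inv_smul₀ h0.ne']
  rw [h2, norm_smul, norm_norm] at h1
  nlinarith

end UltrafilterLimit

lemma Set.IsWF.eventually_eventually_le {ι α : Type*} [LinearOrder α] {s : Set α} (hs : s.IsWF)
    (U : Ultrafilter ι) {u : ι → α} (hu : ∀ k, u k ∈ s) :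
    ∀ᶠ k in (U : Filter ι), ∀ᶠ l in (U : Filter ι), u k ≤ u l := by
  by_contra hcon
  have hG : ∀ᶠ k in (U : Filter ι), ∀ᶠ l in (U : Filter ι), u l < u k := by
    filter_upwards [Ultrafilter.eventually_not.2 hcon] with k hk
    filter_upwards [Ultrafilter.eventually_not.2 hk] with l hl using not_le.1 hl
  set G := {k | ∀ᶠ l in (U : Filter ι), u l < u k}
  have hwf : (u '' G).IsWF := hs.mono (by rintro _ ⟨k, -, rfl⟩; exact hu k)
  obtain ⟨k₀, hk₀⟩ := hG.exists
  have hne : (u '' G).Nonempty := ⟨u k₀, k₀, hk₀, rfl⟩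
  obtain ⟨k, hk, hmin⟩ := hwf.min_mem hne
  obtain ⟨l, hl, hlk⟩ := (hG.and hk).exists
  exact hwf.not_lt_min hne ⟨l, hl, rfl⟩ (hmin ▸ hlk)

/-- The ascending chain condition for infima of linear forms with nonnegative coefficients on the
positive points of overlattices of `ℤ^r`, phrased for a sequence of lattices. -/
lemma not_strictMono_of_lattices {ι : Type*} [Fintype ι] {s : Set ℝ} (hs : s.IsWF)
    {N : ℕ → AddSubgroup (ι → ℝ)} {α : ℕ → ι → ℝ} {m : ℕ → ℝ}
    (hN : ∀ k (z : ι → ℤ), (fun i => (z i : ℝ)) ∈ N k)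
    (hα : ∀ k i, 1 - α k i ∈ s)
    (hlow : ∀ k, ∀ x ∈ N k, (∀ i, 0 < x i) → m k ≤ ∑ i, x i * α k i)
    (hupp : ∀ k, ∃ x ∈ N k, (∀ i, 0 < x i) ∧ ∑ i, x i * α k i < m (k + 1)) :
    ¬ StrictMono m := by
  intro hm
  let U : Ultrafilter ℕ := hyperfilter ℕ
  let L : AddSubgroup (ι → ℝ) := (RingHom.pi fun i : ι =>
    (Int.castRingHom ℝ).comp (Pi.evalRingHom (fun _ => ℤ) i)).toAddMonoidHom.range
  have hsub := eventually_le_limSubgroup U (N := N) (L := L) (R := 1)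
    (by rintro k _ ⟨z, rfl⟩; exact hN k z)
    (fun x => ⟨fun i => (⌊x i⌋ : ℝ), ⟨fun i => ⌊x i⌋, rfl⟩, by
      refine (pi_norm_le_iff_of_nonneg zero_le_one).2 fun i => ?_
      rw [Pi.sub_apply, Int.self_sub_floor, Real.norm_of_nonneg (Int.fract_nonneg _)]
      exact (Int.fract_lt_one _).le⟩)
  have hmono : ∀ᶠ k in (U : Filter ℕ), ∀ i, ∀ᶠ l in (U : Filter ℕ), 1 - α k i ≤ 1 - α l i :=
    eventually_all.2 fun i => hs.eventually_eventually_le U fun k => hα k i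
  obtain ⟨k, hk, hkα⟩ := (hsub.and hmono).exists
  obtain ⟨x, hxN, hx0, hxm⟩ := hupp k
  have hopen : ∀ᶠ y in 𝓝 x, (∀ i, 0 < y i) ∧ ∑ i, y i * α k i < m (k + 1) := by
    refine (eventually_all.2 fun i => ?_).and ?_
    · exact (continuous_apply i).continuousAt.eventually (lt_mem_nhds (hx0 i))
    · have : Continuous fun y : ι → ℝ => ∑ i, y i * α k i := by fun_prop
      exact this.continuousAt.eventually (gt_mem_nhds hxm)
  obtain ⟨ε, hε, hball⟩ := Metric.eventually_nhds_iff.1 hopen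
  have hlarge : ∀ᶠ l in (U : Filter ℕ), k + 1 ≤ l :=
    (Nat.hyperfilter_le_atTop : (hyperfilter ℕ : Filter ℕ) ≤ atTop) (eventually_ge_atTop (k + 1))
  obtain ⟨l, ⟨y, hyN, hyx⟩, hlα, hl⟩ :=
    ((mem_limSubgroup.1 (hk hxN) ε hε).and ((eventually_all.2 hkα).and hlarge)).exists
  obtain ⟨hy0, hym⟩ := hball (by rwa [dist_eq_norm])
  have h1 : ∑ i, y i * α l i ≤ ∑ i, y i * α k i :=
    Finset.sum_le_sum fun i _ => mul_le_mul_of_nonneg_left (by linarith [hlα i]) (hy0 i).le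
  linarith [hlow l y hyN hy0, hm.monotone hl]

section Cone

variable {d n : ℕ} {e : Fin n → Fin d → ℤ}

lemma zero_mem_coneOf : (0 : Fin d → ℝ) ∈ coneOf e := ⟨0, fun _ => le_rfl, by simp⟩

lemma toReal_mem_coneOf (i : Fin n) : toReal (e i) ∈ coneOf e :=
  ⟨Pi.single i 1, fun j => by by_cases h : j = i <;> simp [h],
    by simp [Pi.single_apply]⟩

lemma add_mem_coneOf {x y : Fin d → ℝ} (hx : x ∈ coneOf e) (hy : y ∈ coneOf e) :
    x + y ∈ coneOf e := by
  obtain ⟨c, hc, rfl⟩ := hx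
  obtain ⟨c', hc', rfl⟩ := hy
  exact ⟨c + c', fun i => add_nonneg (hc i) (hc' i), by
    simp [add_smul, Finset.sum_add_distrib]⟩

lemma smul_mem_coneOf {x : Fin d → ℝ} (hx : x ∈ coneOf e) {r : ℝ} (hr : 0 ≤ r) :
    r • x ∈ coneOf e := by
  obtain ⟨c, hc, rfl⟩ := hx
  exact ⟨fun i => r * c i, fun i => mul_nonneg hr (hc i), by
    simp [Finset.smul_sum, smul_smul]⟩

lemma sum_smul_mem_coneOf {ι : Type*} [Fintype ι] {w : ι → Fin d → ℝ} {c : ι → ℝ}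
    (hw : ∀ j, w j ∈ coneOf e) (hc : ∀ j, 0 ≤ c j) : ∑ j, c j • w j ∈ coneOf e :=
  Finset.sum_induction _ (· ∈ coneOf e) (fun _ _ => add_mem_coneOf) zero_mem_coneOf
    fun j _ => smul_mem_coneOf (hw j) (hc j)

lemma nonneg_of_mem_coneOf {ψ : (Fin d → ℝ) →ₗ[ℝ] ℝ} (hψ : ∀ i, 0 ≤ ψ (toReal (e i)))
    {x : Fin d → ℝ} (hx : x ∈ coneOf e) : 0 ≤ ψ x := by
  obtain ⟨c, hc, rfl⟩ := hx
  rw [map_sum]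
  exact Finset.sum_nonneg fun i _ => by
    rw [map_smul, smul_eq_mul]
    exact mul_nonneg (hc i) (hψ i)

lemma smul_add_mem_interior_coneOf {v y : Fin d → ℝ} (hv : v ∈ interior (coneOf e))
    (hy : y ∈ coneOf e) {r : ℝ} (hr : 0 < r) : r • v + y ∈ interior (coneOf e) := by
  rw [mem_interior] at hv ⊢
  obtain ⟨t, hts, ht, hvt⟩ := hv
  refine ⟨y +ᵥ r • t, ?_, (ht.smul₀ hr.ne').vadd y, ?_⟩
  · rintro _ ⟨_, ⟨z, hz, rfl⟩, rfl⟩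
    exact add_mem_coneOf hy (smul_mem_coneOf (hts hz) hr.le)
  · exact ⟨r • v, ⟨v, hvt, rfl⟩, add_comm _ _⟩

/-- If one strictly positive combination of elements of the cone is an interior point, then all
of them are. -/
lemma sum_smul_mem_interior_coneOf {ι : Type*} [Fintype ι] {w : ι → Fin d → ℝ} {c x : ι → ℝ}
    (hw : ∀ j, w j ∈ coneOf e) (hc : ∀ j, 0 < c j) (hx : ∀ j, 0 < x j)
    (hv : ∑ j, c j • w j ∈ interior (coneOf e)) : ∑ j, x j • w j ∈ interior (coneOf e) := by
  obtain ⟨r, hr, hrx⟩ : ∃ r > 0, ∀ j, r * c j ≤ x j := by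
    rcases isEmpty_or_nonempty ι with h | h
    · exact ⟨1, one_pos, fun j => isEmptyElim j⟩
    · obtain ⟨j₀, hj₀⟩ := Finite.exists_min fun j => x j / c j
      exact ⟨x j₀ / c j₀, div_pos (hx _) (hc _), fun j => (le_div_iff₀ (hc j)).1 (hj₀ j)⟩
  have := smul_add_mem_interior_coneOf hv
    (sum_smul_mem_coneOf hw fun j => sub_nonneg.2 (hrx j)) hr
  convert this using 1
  rw [Finset.smul_sum, ← Finset.sum_add_distrib]
  exact Finset.sum_congr rfl fun j _ => by rw [smul_smul, ← add_smul]; congr 1; ring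

/-- Carathéodory's theorem for `coneOf e`, padded with zero vectors to a fixed number of terms. -/
lemma exists_pos_combination_of_mem_coneOf {v : Fin d → ℝ} (hv : v ∈ coneOf e) :
    ∃ (w : Fin (d + 1) → Fin d → ℤ) (c : Fin (d + 1) → ℝ),
      (∀ j, w j = 0 ∨ ∃ i, w j = e i) ∧ (∀ j, 0 < c j) ∧ v = ∑ j, c j • toReal (w j) := by
  obtain ⟨a, ha, rfl⟩ := hv
  rcases (Finset.sum_nonneg fun i _ => ha i : 0 ≤ ∑ i, a i).eq_or_lt with h0 | hpos
  · have ha0 := (Finset.sum_eq_zero_iff_of_nonneg fun i _ => ha i).1 h0.symm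
    refine ⟨0, 1, fun j => .inl rfl, fun j => one_pos, ?_⟩
    rw [Finset.sum_eq_zero fun i hi => by rw [ha0 i hi, zero_smul]]
    exact (Finset.sum_eq_zero fun j _ => by ext; simp [toReal]).symm
  set t := ∑ i, a i
  have hmem : t⁻¹ • ∑ i, a i • toReal (e i) ∈
      convexHull ℝ (Set.range fun i => toReal (e i)) := by
    rw [Finset.smul_sum]
    simp_rw [smul_smul]
    refine (convex_convexHull ℝ _).sum_mem (fun i _ => mul_nonneg (inv_nonneg.2 hpos.le) (ha i))
      ?_ fun i _ => subset_convexHull ℝ _ ⟨i, rfl⟩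
    rw [← Finset.mul_sum, inv_mul_cancel₀ hpos.ne']
  obtain ⟨ι, _, z, q, hz, hind, hq, -, hsum⟩ := eq_pos_convex_span_of_mem_convexHull hmem
  have hcard : Fintype.card ι ≤ d + 1 := by
    have := hind.card_le_finrank_succ
    have h2 := Submodule.finrank_le (vectorSpan ℝ (Set.range z))
    rw [Module.finrank_fin_fun] at h2
    omega
  obtain ⟨f⟩ := Function.Embedding.nonempty_of_card_le (by simpa using hcard :
    Fintype.card ι ≤ Fintype.card (Fin (d + 1)))
  choose g hg using fun i => hz ⟨i, rfl⟩
  refine ⟨Function.extend f (fun i => e (g i)) 0, Function.extend f (fun i => t * q i) 1,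
    fun j => ?_, fun j => ?_, ?_⟩
  · by_cases hj : ∃ i, f i = j
    · obtain ⟨i, rfl⟩ := hj
      exact .inr ⟨g i, f.injective.extend_apply _ _ _⟩
    · exact .inl (Function.extend_apply' _ _ _ hj)
  · by_cases hj : ∃ i, f i = j
    · obtain ⟨i, rfl⟩ := hj
      rw [f.injective.extend_apply]
      exact mul_pos hpos (hq i)
    · rw [Function.extend_apply' _ _ _ hj]
      exact one_pos
  · rw [← smul_inv_smul₀ hpos.ne' (∑ i, a i • toReal (e i)), ← hsum, Finset.smul_sum]
    refine Fintype.sum_of_injective f f.injective _ _ (fun j hj => ?_) fun i => ?_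
    · rw [Function.extend_apply' (fun i => e (g i)) _ _ hj]
      ext; simp [toReal]
    · rw [f.injective.extend_apply, f.injective.extend_apply, smul_smul]
      exact congrArg _ (hg i).symm

/-- The coefficient vectors of combinations of `w` that are integer vectors. -/
def coeffLattice {ι : Type*} [Fintype ι] (w : ι → Fin d → ℤ) : AddSubgroup (ι → ℝ) where
  carrier := {x | ∑ j, x j • toReal (w j) ∈ intLat d}
  zero_mem' := fun i => ⟨0, by simp⟩
  add_mem' := by
    intro x y hx hy i
    obtain ⟨p, hp⟩ := hx i
    obtain ⟨q, hq⟩ := hy i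
    exact ⟨p + q, by
      rw [Int.cast_add, ← hp, ← hq]
      simp [add_smul, Finset.sum_add_distrib]⟩
  neg_mem' := by
    intro x hx i
    obtain ⟨p, hp⟩ := hx i
    exact ⟨-p, by
      rw [Int.cast_neg, ← hp]
      simp⟩

lemma intCast_mem_coeffLattice {ι : Type*} [Fintype ι] (w : ι → Fin d → ℤ) (z : ι → ℤ) :
    (fun j => (z j : ℝ)) ∈ coeffLattice w :=
  fun i => ⟨∑ j, z j * w j i, by simp [toReal]⟩

end Cone

/-- **ACC for toric minimal log discrepancies.** Fix `d ≥ 1` and a DCC set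
`D ⊆ [0, 1]`. The set of all values `a = inf {ψ(v) : v ∈ ℤ^d ∩ int σ}` over all
configurations of primitive `e_1, …, e_n ∈ ℤ^d` whose cone `σ = Σ ℝ_{≥0} • e_i` spans
`ℝ^d`, is strongly convex, and has the rays `ℝ_{≥0} • e_i` as extremal rays, and all linear
forms `ψ` with `ψ(e_i) ≥ 0` and `1 - ψ(e_i) ∈ D`, satisfies ACC. -/
theorem stmt_17 (d : ℕ) (hd : 1 ≤ d) (D : Set ℝ) (hD : D ⊆ Set.Icc 0 1)
    (hDCC : DCCSet D) :
    ACCSet {a : ℝ | ∃ (n : ℕ) (e : Fin n → Fin d → ℤ) (ψ : (Fin d → ℝ) →ₗ[ℝ] ℝ),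
      (∀ i, Primitive (e i)) ∧
      Submodule.span ℝ (coneOf e) = ⊤ ∧
      coneOf e ∩ (-(coneOf e)) = {0} ∧
      (∀ i, IsExtremalRay (coneOf e) (toReal (e i))) ∧
      (∀ i, 0 ≤ ψ (toReal (e i)) ∧ 1 - ψ (toReal (e i)) ∈ D) ∧
      a = sInf {r | ∃ v ∈ intLat d ∩ interior (coneOf e), r = ψ v}} := by
  rintro ⟨f, hf, hmem⟩
  choose n e ψ _ _ _ _ hψ hval using hmem
  have hnonneg : ∀ k, ∀ v ∈ coneOf (e k), 0 ≤ ψ k v := fun k v hv =>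
    nonneg_of_mem_coneOf (fun i => (hψ k i).1) hv
  have hf0 : 0 ≤ f 0 := by
    rw [hval 0]
    refine Real.sInf_nonneg ?_
    rintro _ ⟨v, hv, rfl⟩
    exact hnonneg 0 v (interior_subset hv.2)
  have hle : ∀ k, ∀ v ∈ intLat d ∩ interior (coneOf (e k)), f k ≤ ψ k v := fun k v hv => by
    rw [hval k]
    refine csInf_le ⟨0, ?_⟩ ⟨v, hv, rfl⟩
    rintro _ ⟨v, hv, rfl⟩
    exact hnonneg k v (interior_subset hv.2)
  have hlt : ∀ k, ∃ v ∈ intLat d ∩ interior (coneOf (e (k + 1))),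
      ψ (k + 1) v < f (k + 1 + 1) := fun k => by
    have hne : {r | ∃ v ∈ intLat d ∩ interior (coneOf (e (k + 1))), r = ψ (k + 1) v}.Nonempty := by
      by_contra h
      have h1 := hval (k + 1)
      rw [Set.not_nonempty_iff_eq_empty.1 h, Real.sInf_empty] at h1
      exact absurd (hf k.succ_pos) (by rw [h1]; exact not_lt.2 hf0)
    obtain ⟨_, ⟨v, hv, rfl⟩, hv'⟩ := exists_lt_of_csInf_lt hne
      (by rw [← hval]; exact hf (Nat.lt_succ_self _) : _ < f (k + 1 + 1))
    exact ⟨v, hv, hv'⟩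
  choose v hv hvlt using hlt
  choose w c hw hc hvw using fun k =>
    exists_pos_combination_of_mem_coneOf (interior_subset (hv k).2)
  have hDwf : (D ∪ {1}).IsWF :=
    (Set.isWF_iff_no_descending_seq.2 fun g hg hgD => hDCC ⟨g, hg, hgD⟩).union
      (Set.finite_singleton 1).isWF
  have hw0 : toReal (0 : Fin d → ℤ) = 0 := by ext; simp [toReal]
  have hwcone : ∀ k j, toReal (w k j) ∈ coneOf (e (k + 1)) := fun k j => by
    rcases hw k j with h | ⟨i, h⟩ <;> rw [h]
    · rw [hw0]; exact zero_mem_coneOf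
    · exact toReal_mem_coneOf i
  have hψsum : ∀ k (x : Fin (d + 1) → ℝ), ψ (k + 1) (∑ j, x j • toReal (w k j)) =
      ∑ j, x j * ψ (k + 1) (toReal (w k j)) := fun k x => by simp
  refine not_strictMono_of_lattices hDwf (N := fun k => coeffLattice (w k))
    (α := fun k j => ψ (k + 1) (toReal (w k j))) (m := fun k => f (k + 1))
    (fun k z => intCast_mem_coeffLattice _ z) (fun k j => ?_) (fun k x hxN hx => ?_)
    (fun k => ⟨c k, ?_, hc k, ?_⟩) fun a b hab => hf (Nat.succ_lt_succ hab)
  · rcases hw k j with h | ⟨i, h⟩ <;> rw [h]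
    · right; simp [hw0]
    · exact .inl (hψ (k + 1) i).2
  · rw [← hψsum]
    exact hle (k + 1) _ ⟨hxN, sum_smul_mem_interior_coneOf (hwcone k) (hc k) hx
      (hvw k ▸ (hv k).2)⟩
  · change ∑ j, c k j • toReal (w k j) ∈ intLat d
    rw [← hvw]
    exact (hv k).1
  · rw [← hψsum, ← hvw]
    exact hvlt k
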